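/- arXiv:1712.06629 — 2 statements merged into one kernel-verified Lean document; each statement's English description precedes it below -/
import Mathlib

section
/- Let $f : \mathbb{D}^2 \to \mathbb{R}^2$ be a $C^1$ diffeomorphism onto its image from the closed unit disk, with $\|Df\| \le K$ and $|\det Df| \le L$ everywhere, where $K \ge 1$ and $L \ge 1$. Then there is a universal constant $C$ (one may take $C = 170\pi$) such that for every $1 \le d \le 2$ there exists a countable cover $(U_i)$ of $f(\mathbb{D}^2)$ with $\mathrm{diam}(U_i) \le \sqrt{2}$ for all $i$ and $\sum_i \mathrm{diam}(U_i)^d \le C \cdot \max\{K, L\}^{2-d} \cdot L^{d-1}$. -/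
open Metric MeasureTheory

lemma hasLog_homotopy {A : Type*} [TopologicalSpace A] (H : unitInterval × A → ℂ)
    (hc : Continuous H) (h0 : ∀ z, H z ≠ 0)
    (h : ∃ g : A → ℂ, Continuous g ∧ ∀ a, Complex.exp (g a) = H (0, a)) :
    ∃ g : A → ℂ, Continuous g ∧ ∀ a, Complex.exp (g a) = H (1, a) := by
  obtain ⟨g, hg, hgH⟩ := h
  let H' : C(unitInterval × A, {z : ℂ // z ≠ 0}) := ⟨fun z => ⟨H z, h0 z⟩, by fun_prop⟩
  have h0' : ∀ a, H' (0, a) = (fun z : ℂ ↦ (⟨_, z.exp_ne_zero⟩ : {z : ℂ // z ≠ 0})) ((⟨g, hg⟩ : C(A, ℂ)) a) := by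
    intro a
    apply Subtype.ext
    exact (hgH a).symm
  let G := Complex.isCoveringMap_exp.liftHomotopy H' ⟨g, hg⟩ h0'
  refine ⟨fun a => G (1, a), by fun_prop, fun a => ?_⟩
  have := congr_fun (Complex.isCoveringMap_exp.liftHomotopy_lifts H' ⟨g, hg⟩ h0') (1, a)
  exact congr_arg Subtype.val this

lemma odd_no_log (F : sphere (0 : EuclideanSpace ℝ (Fin 2)) 1 → ℂ)
    (hodd : ∀ x, F (-x) = - F x)
    (h : ∃ g : sphere (0 : EuclideanSpace ℝ (Fin 2)) 1 → ℂ, Continuous g ∧ ∀ a, Complex.exp (g a) = F a) :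
    False := by
  obtain ⟨g, hg, hgF⟩ := h
  have hconn : IsPreconnected (sphere (0 : EuclideanSpace ℝ (Fin 2)) 1) :=
    isPreconnected_sphere (by
      rw [← Module.finrank_eq_rank]; simp) 0 1
  have : PreconnectedSpace (sphere (0 : EuclideanSpace ℝ (Fin 2)) 1) :=
    isPreconnected_iff_preconnectedSpace.mp hconn
  have hne : (sphere (0 : EuclideanSpace ℝ (Fin 2)) 1).Nonempty := NormedSpace.sphere_nonempty.mpr zero_le_one
  obtain ⟨x0, hx0⟩ := hne
  let x : sphere (0 : EuclideanSpace ℝ (Fin 2)) 1 := ⟨x0, hx0⟩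
  -- integer-valued function
  have key : ∀ a, ∃ n : ℤ, g (-a) - g a = Real.pi * Complex.I + n * (2 * Real.pi * Complex.I) := by
    intro a
    have : Complex.exp (g (-a)) = Complex.exp (g a + Real.pi * Complex.I) := by
      rw [hgF, hodd, Complex.exp_add, Complex.exp_pi_mul_I, hgF]; ring
    obtain ⟨n, hn⟩ := Complex.exp_eq_exp_iff_exists_int.mp this
    exact ⟨n, by rw [hn]; ring⟩
  choose n hn using key
  have hcn : Continuous n := by
    have h1 : Continuous (fun a => (((g (-a) - g a) - Real.pi * Complex.I) / (2 * Real.pi * Complex.I)).re) := by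
      have : Continuous fun a : sphere (0 : EuclideanSpace ℝ (Fin 2)) 1 => -a := continuous_neg
      fun_prop
    have h2 : (fun a => (((g (-a) - g a) - Real.pi * Complex.I) / (2 * Real.pi * Complex.I)).re) = fun a => ((n a : ℤ) : ℝ) := by
      funext a
      rw [hn a, add_sub_cancel_left, mul_div_cancel_right₀ _ Complex.two_pi_I_ne_zero]
      simp
    rw [h2] at h1
    exact Int.isClosedEmbedding_coe_real.isInducing.continuous_iff.mpr h1
  have hconst : n (-x) = n x := PreconnectedSpace.constant inferInstance hcn
  have e1 := hn x
  have e2 := hn (-x)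
  rw [neg_neg, hconst] at e2
  have e3 : (1 + 2 * (n x : ℂ)) * (2 * Real.pi * Complex.I) = 0 := by
    linear_combination - e1 - e2
  have e4 := (mul_eq_zero.mp e3).resolve_right Complex.two_pi_I_ne_zero
  have e5 : (1 + 2 * n x : ℤ) = 0 := by exact_mod_cast e4
  omega

lemma image_fill (F : EuclideanSpace ℝ (Fin 2) → ℂ)
    (hF : ContinuousOn F (closedBall 0 1)) (hinj : Set.InjOn F (closedBall 0 1))
    (x0 : EuclideanSpace ℝ (Fin 2)) (hx0 : x0 ∈ closedBall (0 : EuclideanSpace ℝ (Fin 2)) 1) (q : ℂ)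
    (hseg : ∀ t : unitInterval, ∀ x ∈ sphere (0 : EuclideanSpace ℝ (Fin 2)) 1,
      F x ≠ q + (t : ℝ) * (F x0 - q)) :
    q ∈ F '' closedBall 0 1 := by
  by_contra hq
  have hx0' : ‖x0‖ < 1 := by
    have h1 : ‖x0‖ ≤ 1 := by simpa using hx0
    refine lt_of_le_of_ne h1 fun h => ?_
    exact hseg 1 x0 (by simpa using h) (by simp)
  have cF : ∀ φ : unitInterval × sphere (0 : EuclideanSpace ℝ (Fin 2)) 1 → EuclideanSpace ℝ (Fin 2),
      Continuous φ → (∀ z, ‖φ z‖ ≤ 1) → Continuous fun z => F (φ z) := fun φ h1 h2 =>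
    hF.comp_continuous h1 fun z => by simpa using h2 z
  have nA : ∀ a : sphere (0 : EuclideanSpace ℝ (Fin 2)) 1, ‖(a : EuclideanSpace ℝ (Fin 2))‖ = 1 := fun a => by simp
  have tI : ∀ t : unitInterval, |(t : ℝ)| ≤ 1 := fun t => by
    rw [abs_of_nonneg t.2.1]; exact t.2.2
  have n1 : ∀ z : unitInterval × sphere (0 : EuclideanSpace ℝ (Fin 2)) 1,
      ‖(z.1 : ℝ) • (z.2 : EuclideanSpace ℝ (Fin 2))‖ ≤ 1 := fun z => by
    rw [norm_smul, nA, mul_one]; exact tI _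
  -- step 1
  have s1 := hasLog_homotopy
    (fun z : unitInterval × sphere (0 : EuclideanSpace ℝ (Fin 2)) 1 => F ((z.1 : ℝ) • (z.2 : EuclideanSpace ℝ (Fin 2))) - q)
    ((cF _ (by fun_prop) n1).sub continuous_const)
    (fun z h => hq ⟨_, by simpa using n1 z, sub_eq_zero.mp h⟩)
    ⟨fun _ => Complex.log (F 0 - q), continuous_const, fun a => by
      rw [Complex.exp_log]
      · simp
      · exact fun h => hq ⟨0, by simp, sub_eq_zero.mp h⟩⟩
  -- step 2
  have s2 := hasLog_homotopy
    (fun z : unitInterval × sphere (0 : EuclideanSpace ℝ (Fin 2)) 1 => F (z.2 : EuclideanSpace ℝ (Fin 2)) - (q + (z.1 : ℝ) * (F x0 - q)))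
    ((cF _ (by fun_prop) (fun z => (nA _).le)).sub (by fun_prop))
    (fun z h => hseg z.1 z.2 z.2.2 (sub_eq_zero.mp h))
    (by simpa using s1)
  -- step 3
  have n3 : ∀ t : unitInterval, ‖(1 - (t : ℝ)) • x0‖ < 1 := fun t => by
    rw [norm_smul, Real.norm_eq_abs, abs_of_nonneg (by linarith [t.2.2])]
    nlinarith [t.2.1, t.2.2, norm_nonneg x0]
  have s3 := hasLog_homotopy
    (fun z : unitInterval × sphere (0 : EuclideanSpace ℝ (Fin 2)) 1 => F (z.2 : EuclideanSpace ℝ (Fin 2)) - F ((1 - (z.1 : ℝ)) • x0))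
    ((cF _ (by fun_prop) (fun z => (nA _).le)).sub (cF _ (by fun_prop) (fun z => (n3 _).le)))
    (fun z h => by
      have := hinj (by simpa using (nA z.2).le) (by simpa using (n3 z.1).le) (sub_eq_zero.mp h)
      have h1 := n3 z.1
      rw [← this, nA] at h1
      exact lt_irrefl _ h1)
    (by simpa using s2)
  -- step 4
  have n4 : ∀ z : unitInterval × sphere (0 : EuclideanSpace ℝ (Fin 2)) 1,
      ‖(1 - (z.1 : ℝ) / 2) • (z.2 : EuclideanSpace ℝ (Fin 2))‖ ≤ 1 := fun z => by
    rw [norm_smul, nA, mul_one, Real.norm_eq_abs, abs_le]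
    constructor <;> linarith [z.1.2.1, z.1.2.2]
  have n4' : ∀ z : unitInterval × sphere (0 : EuclideanSpace ℝ (Fin 2)) 1,
      ‖(-((z.1 : ℝ) / 2)) • (z.2 : EuclideanSpace ℝ (Fin 2))‖ ≤ 1 := fun z => by
    rw [norm_smul, nA, mul_one, Real.norm_eq_abs, abs_le]
    constructor <;> linarith [z.1.2.1, z.1.2.2]
  have s4 := hasLog_homotopy
    (fun z : unitInterval × sphere (0 : EuclideanSpace ℝ (Fin 2)) 1 => F ((1 - (z.1 : ℝ) / 2) • (z.2 : EuclideanSpace ℝ (Fin 2)))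
      - F ((-((z.1 : ℝ) / 2)) • (z.2 : EuclideanSpace ℝ (Fin 2))))
    ((cF _ (by fun_prop) n4).sub (cF _ (by fun_prop) n4'))
    (fun z h => by
      have := hinj (by simpa using n4 z) (by simpa using n4' z) (sub_eq_zero.mp h)
      have hz : (z.2 : EuclideanSpace ℝ (Fin 2)) = 0 := by
        have h3 := sub_eq_zero.mpr this
        rw [← sub_smul] at h3
        have h4 : (1 - (z.1 : ℝ) / 2 - -((z.1 : ℝ) / 2)) = 1 := by ring
        rwa [h4, one_smul] at h3
      have := nA z.2
      rw [hz] at this; simp at this)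
    (by simpa using s3)
  refine odd_no_log _ ?_ s4
  intro x
  have e' : (((1 : unitInterval) : ℝ) / 2) = 1/2 := by simp
  simp only [e']
  have e3 : (1 - 1 / 2 : ℝ) = 1 / 2 := by norm_num
  rw [e3]
  simp

def gridCell (r : ℝ) (z : ℤ × ℤ) : Set (EuclideanSpace ℝ (Fin 2)) :=
  {y | ⌊y 0 / r⌋ = z.1 ∧ ⌊y 1 / r⌋ = z.2}

lemma mem_floor_iff {r : ℝ} (hr : 0 < r) (a : ℝ) (i : ℤ) :
    ⌊a / r⌋ = i ↔ i * r ≤ a ∧ a < (i + 1) * r := by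
  rw [Int.floor_eq_iff, le_div_iff₀ hr, div_lt_iff₀ hr]

lemma gridCell_eq {r : ℝ} (hr : 0 < r) (z : ℤ × ℤ) :
    gridCell r z = (@WithLp.ofLp 2 (Fin 2 → ℝ)) ⁻¹'
      (Set.univ.pi fun k : Fin 2 => Set.Ico ((![(z.1 : ℝ) * r, z.2 * r] : Fin 2 → ℝ) k)
        ((![((z.1 : ℝ) + 1) * r, (z.2 + 1) * r] : Fin 2 → ℝ) k)) := by
  ext y
  simp [gridCell, mem_floor_iff hr]

lemma gridCell_meas {r : ℝ} (hr : 0 < r) (z : ℤ × ℤ) : MeasurableSet (gridCell r z) := by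
  rw [gridCell_eq hr]
  exact (PiLp.volume_preserving_ofLp (Fin 2)).measurable
    (MeasurableSet.univ_pi fun _ => measurableSet_Ico)

lemma gridCell_volume {r : ℝ} (hr : 0 < r) (z : ℤ × ℤ) :
    volume (gridCell r z) = ENNReal.ofReal (r ^ 2) := by
  rw [gridCell_eq hr, (PiLp.volume_preserving_ofLp (Fin 2)).measure_preimage
    (MeasurableSet.univ_pi fun _ => measurableSet_Ico).nullMeasurableSet, Real.volume_pi_Ico]
  simp only [Fin.prod_univ_two, Matrix.cons_val_zero, Matrix.cons_val_one]
  rw [← ENNReal.ofReal_mul (by nlinarith)]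
  congr 1; ring

lemma gridCell_diam {r : ℝ} (hr : 0 < r) (z : ℤ × ℤ) :
    EMetric.diam (gridCell r z) ≤ ENNReal.ofReal (Real.sqrt 2 * r) := by
  refine Metric.ediam_le fun x hx y hy => ?_
  rw [edist_dist]
  apply ENNReal.ofReal_le_ofReal
  simp only [gridCell, Set.mem_setOf_eq, mem_floor_iff hr] at hx hy
  rw [EuclideanSpace.dist_eq, Fin.sum_univ_two, Real.dist_eq, Real.dist_eq, sq_abs, sq_abs]
  apply Real.sqrt_le_iff.mpr
  refine ⟨by positivity, ?_⟩
  rw [mul_pow, Real.sq_sqrt zero_le_two]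
  have h1 : (x 0 - y 0) ^ 2 ≤ r ^ 2 := by
    apply sq_le_sq'  <;> nlinarith
  have h2 : (x 1 - y 1) ^ 2 ≤ r ^ 2 := by
    apply sq_le_sq'  <;> nlinarith
  linarith

lemma gridCell_disj (r : ℝ) : Pairwise (Function.onFun Disjoint (gridCell r)) := by
  intro a b hab
  refine Set.disjoint_left.mpr fun x hx hy => hab ?_
  exact Prod.ext (hx.1.symm.trans hy.1) (hx.2.symm.trans hy.2)

lemma gridCell_convex {r : ℝ} (hr : 0 < r) (z : ℤ × ℤ) {p q : EuclideanSpace ℝ (Fin 2)}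
    (hp : p ∈ gridCell r z) (hq : q ∈ gridCell r z) (t : ℝ) (h0 : 0 ≤ t) (h1 : t ≤ 1) :
    q + t • (p - q) ∈ gridCell r z := by
  simp only [gridCell, Set.mem_setOf_eq, mem_floor_iff hr] at *
  simp only [PiLp.add_apply, PiLp.smul_apply, PiLp.sub_apply, smul_eq_mul]
  obtain ⟨⟨a1, a2⟩, a3, a4⟩ := hp
  obtain ⟨⟨b1, b2⟩, b3, b4⟩ := hq
  have key : ∀ l u a b : ℝ, l ≤ a → a < u → l ≤ b → b < u → l ≤ b + t * (a - b) ∧ b + t * (a - b) < u := by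
    intro l u a b h3 h4 h5 h6
    constructor
    · nlinarith [mul_nonneg h0 (sub_nonneg.mpr h3), mul_nonneg (sub_nonneg.mpr h1) (sub_nonneg.mpr h5)]
    · rcases h0.eq_or_lt with rfl | h0
      · simpa using h6
      · nlinarith [mul_pos h0 (sub_pos.mpr h4), mul_nonneg (sub_nonneg.mpr h1) (sub_pos.mpr h6).le]
  exact ⟨key _ _ _ _ a1 a2 b1 b2, key _ _ _ _ a3 a4 b3 b4⟩

/-- points within distance `r` have floor indices differing by at most one -/
lemma floor_near {r : ℝ} (hr : 0 < r) (a b : ℝ) (h : |a - b| ≤ r) :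
    ⌊a / r⌋ ∈ Finset.Icc (⌊b / r⌋ - 1) (⌊b / r⌋ + 1) := by
  have h1 : |a / r - b / r| ≤ 1 := by
    rw [← sub_div, abs_div, abs_of_pos hr, div_le_one hr]; exact h
  rw [abs_le] at h1
  rw [Finset.mem_Icc]
  constructor
  · rw [← Int.floor_sub_one]; exact Int.floor_le_floor (by linarith)
  · rw [← Int.floor_add_one]; exact Int.floor_le_floor (by linarith)

lemma coord_le_dist (x y : EuclideanSpace ℝ (Fin 2)) (k : Fin 2) : |x k - y k| ≤ dist x y := by
  rw [dist_eq_norm]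
  simpa using PiLp.norm_apply_le (x - y) k

lemma dist_exp_le (s t : ℝ) :
    dist (Complex.exp (s * Complex.I)) (Complex.exp (t * Complex.I)) ≤ |s - t| := by
  have h : Complex.exp (s * Complex.I) - Complex.exp (t * Complex.I)
      = Complex.exp (t * Complex.I) * (Complex.exp (Complex.I * ((s - t : ℝ) : ℂ)) - 1) := by
    rw [mul_sub, ← Complex.exp_add]; push_cast; ring_nf
  rw [dist_eq_norm, h, norm_mul, Complex.norm_exp_ofReal_mul_I, one_mul]
  exact Real.norm_exp_I_mul_ofReal_sub_one_le

lemma circle_cells (K r : ℝ) (hK : 1 ≤ K) (hr : 0 < r)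
    (f : EuclideanSpace ℝ (Fin 2) → EuclideanSpace ℝ (Fin 2))
    (hlip : ∀ x ∈ closedBall (0 : EuclideanSpace ℝ (Fin 2)) 1,
      ∀ y ∈ closedBall (0 : EuclideanSpace ℝ (Fin 2)) 1, dist (f x) (f y) ≤ K * dist x y) :
    ∃ B : Finset (ℤ × ℤ), (B.card : ℝ) ≤ 9 * (2 * Real.pi * K / r + 2) ∧
      ∀ z, ∀ x ∈ sphere (0 : EuclideanSpace ℝ (Fin 2)) 1, f x ∈ gridCell r z → z ∈ B := by
  let e := Complex.orthonormalBasisOneI.repr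
  have hπ := Real.pi_pos
  let γ : ℝ → EuclideanSpace ℝ (Fin 2) := fun θ => e (Complex.exp (θ * Complex.I))
  have hγ : ∀ s, γ s ∈ closedBall (0 : EuclideanSpace ℝ (Fin 2)) 1 := by
    intro s
    simp only [γ, mem_closedBall, dist_zero_right, LinearIsometryEquiv.norm_map,
      Complex.norm_exp_ofReal_mul_I, le_refl]
  have hpos : 0 < 2 * Real.pi * K / r := by positivity
  let m : ℕ := ⌈2 * Real.pi * K / r⌉₊
  have hm1 : 2 * Real.pi * K / r ≤ m := Nat.le_ceil _
  have hm2 : (m : ℝ) < 2 * Real.pi * K / r + 1 := Nat.ceil_lt_add_one hpos.le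
  have hm0 : (0 : ℝ) < m := hpos.trans_le hm1
  let c : ℕ → EuclideanSpace ℝ (Fin 2) := fun k => f (γ (2 * Real.pi * k / m - Real.pi))
  refine ⟨(Finset.range (m + 1)).biUnion fun k =>
    Finset.Icc (⌊c k 0 / r⌋ - 1) (⌊c k 0 / r⌋ + 1) ×ˢ
      Finset.Icc (⌊c k 1 / r⌋ - 1) (⌊c k 1 / r⌋ + 1), ?_, ?_⟩
  · have h := Finset.card_biUnion_le_card_mul (Finset.range (m + 1)) (fun k =>
      Finset.Icc (⌊c k 0 / r⌋ - 1) (⌊c k 0 / r⌋ + 1) ×ˢ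
      Finset.Icc (⌊c k 1 / r⌋ - 1) (⌊c k 1 / r⌋ + 1)) 9 (by
        intro k _
        rw [Finset.card_product, Int.card_Icc, Int.card_Icc]
        have : ∀ a : ℤ, (a + 1 + 1 - (a - 1)).toNat = 3 := fun a => by
          have : a + 1 + 1 - (a - 1) = 3 := by ring
          rw [this]; rfl
        rw [this, this])
    rw [Finset.card_range] at h
    have h' : ((Finset.biUnion (Finset.range (m + 1)) (fun k =>
      Finset.Icc (⌊c k 0 / r⌋ - 1) (⌊c k 0 / r⌋ + 1) ×ˢ
      Finset.Icc (⌊c k 1 / r⌋ - 1) (⌊c k 1 / r⌋ + 1))).card : ℝ) ≤ (m + 1) * 9 := by exact_mod_cast h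
    linarith
  · intro z x hx hz
    have hn : ‖e.symm x‖ = 1 := by simpa using hx
    set θ := Complex.arg (e.symm x) with hθ
    have hxγ : x = γ θ := by
      have := Complex.norm_mul_exp_arg_mul_I (e.symm x)
      rw [hn, Complex.ofReal_one, one_mul] at this
      simp only [γ, hθ]
      rw [this]; simp
    have hθ1 : -Real.pi < θ := Complex.neg_pi_lt_arg _
    have hθ2 : θ ≤ Real.pi := Complex.arg_le_pi _
    let w : ℝ := (θ + Real.pi) * m / (2 * Real.pi)
    have hw0 : 0 ≤ w := by
      have : 0 ≤ θ + Real.pi := by linarith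
      positivity
    have hw1 : w ≤ m := by
      rw [div_le_iff₀ (by positivity)]; nlinarith
    let k : ℕ := ⌊w⌋₊
    have hk1 : (k : ℝ) ≤ w := Nat.floor_le hw0
    have hk2 : w < k + 1 := Nat.lt_floor_add_one w
    have hkm : k < m + 1 := by
      have : (k : ℝ) ≤ m := hk1.trans hw1
      have : k ≤ m := by exact_mod_cast this
      omega
    have hθw : θ = 2 * Real.pi * w / m - Real.pi := by
      simp only [w]; field_simp; ring
    have hd : dist (f x) (c k) ≤ r := by
      have h1 := hlip (γ θ) (hγ _) (γ (2 * Real.pi * k / m - Real.pi)) (hγ _)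
      have h2 : dist (γ θ) (γ (2 * Real.pi * k / m - Real.pi)) ≤ 2 * Real.pi / m := by
        simp only [γ, LinearIsometryEquiv.dist_map]
        refine (dist_exp_le _ _).trans ?_
        have : θ - (2 * Real.pi * k / m - Real.pi) = (2 * Real.pi / m) * (w - k) := by
          rw [hθw]; ring
        rw [this, abs_of_nonneg (mul_nonneg (by positivity) (by linarith))]
        exact mul_le_of_le_one_right (by positivity) (by linarith)
      rw [hxγ]
      refine h1.trans ((mul_le_mul_of_nonneg_left h2 (by linarith)).trans ?_)
      rw [div_le_iff₀ hr] at hm1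
      rw [← mul_div_assoc, div_le_iff₀ hm0]; linarith
    rw [Finset.mem_biUnion]
    refine ⟨k, Finset.mem_range.mpr hkm, ?_⟩
    rw [Finset.mem_product]
    constructor
    · rw [← hz.1]; exact floor_near hr _ _ ((coord_le_dist _ _ _).trans hd)
    · rw [← hz.2]; exact floor_near hr _ _ ((coord_le_dist _ _ _).trans hd)

lemma final_ineq (K L M r d : ℝ) (hK : 1 ≤ K) (hL : 1 ≤ L) (hM : M = max K L) (hr : r = L / M)
    (hd1 : 1 ≤ d) (hd2 : d ≤ 2) :
    (Real.sqrt 2 * r) ^ d * (Real.pi * L / r ^ 2 + 9 * (2 * Real.pi * K / r + 2)) ≤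
      (170 * Real.pi) * M ^ (2 - d) * L ^ (d - 1) := by
  have hKM : K ≤ M := hM ▸ le_max_left _ _
  have hLM : L ≤ M := hM ▸ le_max_right _ _
  have hM0 : 0 < M := by linarith
  have hL0 : 0 < L := by linarith
  have hr0 : 0 < r := by rw [hr]; positivity
  have hr1 : r ≤ 1 := by rw [hr, div_le_one hM0]; exact hLM
  have hπ := Real.pi_gt_three
  have e1 : (Real.sqrt 2) ^ d ≤ 2 := by
    calc (Real.sqrt 2) ^ d ≤ (Real.sqrt 2) ^ (2 : ℝ) :=
          Real.rpow_le_rpow_of_exponent_le (by rw [Real.one_le_sqrt]; norm_num) hd2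
      _ = 2 := by rw [Real.rpow_two]; exact Real.sq_sqrt zero_le_two
  have e2 : r ^ d = r * (L ^ (d - 1) / M ^ (d - 1)) := by
    rw [← Real.div_rpow hL0.le hM0.le, ← hr]
    conv_rhs => rw [← Real.rpow_one r]
    rw [Real.rpow_one, ← Real.rpow_one_add' hr0.le (by linarith)]; congr 1; ring
  have e3 : M ^ (2 - d) = M / M ^ (d - 1) := by
    rw [eq_div_iff (by positivity), ← Real.rpow_add hM0]
    have : (2 - d + (d - 1)) = 1 := by ring
    rw [this, Real.rpow_one]
  rw [Real.mul_rpow (by positivity) hr0.le, e2, e3]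
  have hP : 0 < L ^ (d - 1) / M ^ (d - 1) := by positivity
  have hR : 170 * Real.pi * (M / M ^ (d - 1)) * L ^ (d - 1) =
    (L ^ (d - 1) / M ^ (d - 1)) * (170 * Real.pi * M) := by ring
  rw [hR]
  set P := L ^ (d - 1) / M ^ (d - 1)
  set X := Real.pi * L / r ^ 2 + 9 * (2 * Real.pi * K / r + 2) with hX
  have hX0 : 0 ≤ X := by positivity
  have hrX : r * X ≤ 85 * Real.pi * M := by
    have : r * X = Real.pi * (L / r) + 18 * Real.pi * K + 18 * r := by
      rw [hX]; field_simp; ring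
    have h2 : L / r = M := by rw [hr]; field_simp
    rw [this, h2]
    nlinarith
  calc Real.sqrt 2 ^ d * (r * P) * X = Real.sqrt 2 ^ d * (P * (r * X)) := by ring
    _ ≤ 2 * (P * (85 * Real.pi * M)) := by gcongr
    _ = _ := by ring

lemma cell_fill (f : EuclideanSpace ℝ (Fin 2) → EuclideanSpace ℝ (Fin 2))
    (hf : ContinuousOn f (closedBall 0 1)) (hinj : Set.InjOn f (closedBall 0 1))
    {r : ℝ} (hr : 0 < r) (z : ℤ × ℤ)
    (hne : (gridCell r z ∩ f '' closedBall 0 1).Nonempty)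
    (hs : ∀ x ∈ sphere (0 : EuclideanSpace ℝ (Fin 2)) 1, f x ∉ gridCell r z) :
    gridCell r z ⊆ f '' closedBall 0 1 := by
  intro q hq
  obtain ⟨_, hp, x0, hx0, rfl⟩ := hne
  let e := Complex.orthonormalBasisOneI.repr
  have := image_fill (fun x => e.symm (f x)) (e.symm.continuous.comp_continuousOn hf)
    (fun x hx y hy h => hinj hx hy (e.symm.injective h)) x0 hx0 (e.symm q) (by
      intro t x hx h
      apply hs x hx
      have h2 : e.symm (f x) = e.symm (q + (t : ℝ) • (f x0 - q)) := by
        rw [h, map_add, map_smul, map_sub, Complex.real_smul]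
      rw [e.symm.injective h2]
      exact gridCell_convex hr z hp hq t t.2.1 t.2.2)
  obtain ⟨x, hx, h⟩ := this
  exact ⟨x, hx, e.symm.injective h⟩

/-- Hausdorff premeasure (at scale √2) bound for the image of the unit disk
under a C¹ diffeomorphism with derivative bounded by `K` and Jacobian bounded by `L`. -/
theorem stmt1 (K L : ℝ) (hK : 1 ≤ K) (hL : 1 ≤ L)
    (f : EuclideanSpace ℝ (Fin 2) → EuclideanSpace ℝ (Fin 2))
    (f' : EuclideanSpace ℝ (Fin 2) → (EuclideanSpace ℝ (Fin 2) →L[ℝ] EuclideanSpace ℝ (Fin 2)))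
    (hC1 : ContDiffOn ℝ 1 f (closedBall (0 : EuclideanSpace ℝ (Fin 2)) 1))
    (hinj : Set.InjOn f (closedBall (0 : EuclideanSpace ℝ (Fin 2)) 1))
    (hdiff : ∀ x ∈ closedBall (0 : EuclideanSpace ℝ (Fin 2)) 1,
      HasFDerivWithinAt f (f' x) (closedBall (0 : EuclideanSpace ℝ (Fin 2)) 1) x)
    (hDf : ∀ x ∈ closedBall (0 : EuclideanSpace ℝ (Fin 2)) 1, ‖f' x‖ ≤ K)
    (hJac : ∀ x ∈ closedBall (0 : EuclideanSpace ℝ (Fin 2)) 1, |(f' x).det| ≤ L)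
    (d : ℝ) (hd1 : 1 ≤ d) (hd2 : d ≤ 2) :
    ∃ U : ℕ → Set (EuclideanSpace ℝ (Fin 2)),
      (f '' closedBall (0 : EuclideanSpace ℝ (Fin 2)) 1 ⊆ ⋃ i, U i) ∧
      (∀ i, EMetric.diam (U i) ≤ ENNReal.ofReal (Real.sqrt 2)) ∧
      ∑' i, EMetric.diam (U i) ^ d ≤
        ENNReal.ofReal ((170 * Real.pi) * (max K L) ^ (2 - d) * L ^ (d - 1)) := by
  classical
  set M := max K L with hM
  have hLM : L ≤ M := le_max_right _ _
  have hM0 : 0 < M := by linarith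
  obtain ⟨r, hrdef⟩ : ∃ r, r = L / M := ⟨_, rfl⟩
  have hr : 0 < r := by rw [hrdef]; positivity
  have hr1 : r ≤ 1 := by rw [hrdef, div_le_one hM0]; exact hLM
  have hπ := Real.pi_pos
  have hlip : ∀ x ∈ closedBall (0 : EuclideanSpace ℝ (Fin 2)) 1,
      ∀ y ∈ closedBall (0 : EuclideanSpace ℝ (Fin 2)) 1, dist (f x) (f y) ≤ K * dist x y := by
    intro x hx y hy
    rw [dist_eq_norm, dist_eq_norm]
    exact (convex_closedBall _ _).norm_image_sub_le_of_norm_hasFDerivWithin_le hdiff hDf hy hx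
  obtain ⟨B, hBcard, hB⟩ := circle_cells K r hK hr f hlip
  set S := f '' closedBall (0 : EuclideanSpace ℝ (Fin 2)) 1 with hS
  have hvol : volume S ≤ ENNReal.ofReal (Real.pi * L) := by
    rw [hS, ← lintegral_abs_det_fderiv_eq_addHaar_image volume measurableSet_closedBall hdiff hinj]
    calc _ ≤ ∫⁻ x in closedBall (0 : EuclideanSpace ℝ (Fin 2)) 1, ENNReal.ofReal L :=
          setLIntegral_mono measurable_const fun x hx => ENNReal.ofReal_le_ofReal (hJac x hx)
      _ = ENNReal.ofReal (Real.pi * L) := by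
          rw [setLIntegral_const, EuclideanSpace.volume_closedBall_fin_two, mul_comm Real.pi,
            ENNReal.ofReal_mul (by linarith)]
          simp [ENNReal.ofReal, NNReal.pi, Real.toNNReal_of_nonneg hπ.le]
  let T : Set (ℤ × ℤ) := {z | gridCell r z ⊆ S}
  let V : ℤ × ℤ → Set (EuclideanSpace ℝ (Fin 2)) := fun z =>
    if (gridCell r z ∩ S).Nonempty then gridCell r z else ∅
  have hVd : ∀ z, EMetric.diam (V z) ≤ ENNReal.ofReal (Real.sqrt 2 * r) := by
    intro z
    by_cases h : (gridCell r z ∩ S).Nonempty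
    · simp only [V, if_pos h]; exact gridCell_diam hr z
    · simp only [V, if_neg h]
      exact (Metric.ediam_empty (X := EuclideanSpace ℝ (Fin 2))).le.trans zero_le
  -- number of interior cells
  have hT : ∑' z, T.indicator (fun _ => (1 : ENNReal)) z ≤ ENNReal.ofReal (Real.pi * L / r ^ 2) := by
    have h1 : (∑' z, T.indicator (fun _ => (1 : ENNReal)) z) * ENNReal.ofReal (r ^ 2)
        ≤ ENNReal.ofReal (Real.pi * L) := by
      rw [← ENNReal.tsum_mul_right]
      refine le_trans ?_ hvol
      calc _ = ∑' z, volume (if z ∈ T then gridCell r z else ∅) := by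
            refine tsum_congr fun z => ?_
            by_cases h : z ∈ T
            · rw [Set.indicator_of_mem h, if_pos h, gridCell_volume hr, one_mul]
            · rw [Set.indicator_of_notMem h, if_neg h, measure_empty, zero_mul]
        _ = volume (⋃ z, (if z ∈ T then gridCell r z else ∅)) := by
            rw [measure_iUnion]
            · intro a b hab
              refine Set.disjoint_left.mpr fun x hx hy => ?_
              have h3 : ∀ c, x ∈ (if c ∈ T then gridCell r c else ∅) → x ∈ gridCell r c := by
                intro c hc
                split_ifs at hc with h
                · exact hc
                · exact hc.elim
              exact Set.disjoint_left.mp (gridCell_disj r hab) (h3 a hx) (h3 b hy)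
            · intro z
              split_ifs
              · exact gridCell_meas hr z
              · exact MeasurableSet.empty
        _ ≤ volume S := by
            apply measure_mono
            refine Set.iUnion_subset fun z => ?_
            split_ifs with h
            · exact h
            · exact Set.empty_subset _
    rw [ENNReal.ofReal_div_of_pos (by positivity)]
    rwa [ENNReal.le_div_iff_mul_le (Or.inl (by
      rw [Ne, ENNReal.ofReal_eq_zero, not_le]; positivity)) (Or.inl ENNReal.ofReal_ne_top)]
  have hBs : ∑' z, (B : Set (ℤ × ℤ)).indicator (fun _ => (1 : ENNReal)) z
      ≤ ENNReal.ofReal (9 * (2 * Real.pi * K / r + 2)) := by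
    rw [← tsum_subtype, Finset.tsum_subtype' B (fun _ => (1 : ENNReal))]
    simp only [Finset.sum_const, nsmul_eq_mul, mul_one]
    rw [← ENNReal.ofReal_natCast]
    exact ENNReal.ofReal_le_ofReal hBcard
  have hpt : ∀ z, EMetric.diam (V z) ^ d ≤ ENNReal.ofReal ((Real.sqrt 2 * r) ^ d) *
      (T.indicator (fun _ => (1 : ENNReal)) z +
        (B : Set (ℤ × ℤ)).indicator (fun _ => (1 : ENNReal)) z) := by
    intro z
    by_cases h : (gridCell r z ∩ S).Nonempty
    · have h1 : EMetric.diam (V z) ^ d ≤ ENNReal.ofReal ((Real.sqrt 2 * r) ^ d) := by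
        rw [← ENNReal.ofReal_rpow_of_nonneg (by positivity) (by linarith)]
        exact ENNReal.rpow_le_rpow (hVd z) (by linarith)
      refine h1.trans (le_mul_of_one_le_right' ?_)
      by_cases hs : ∀ x ∈ sphere (0 : EuclideanSpace ℝ (Fin 2)) 1, f x ∉ gridCell r z
      · have : z ∈ T := cell_fill f hC1.continuousOn hinj hr z h hs
        rw [Set.indicator_of_mem this]
        exact le_self_add
      · push Not at hs
        obtain ⟨x, hx, hxz⟩ := hs
        have : z ∈ (B : Set (ℤ × ℤ)) := hB z x hx hxz
        rw [Set.indicator_of_mem this]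
        exact le_add_self
    · simp only [V, if_neg h]
      have h0 : EMetric.diam (∅ : Set (EuclideanSpace ℝ (Fin 2))) = 0 := Metric.ediam_empty
      rw [h0, ENNReal.zero_rpow_of_pos (by linarith)]
      exact zero_le
  let eq := (Denumerable.eqv (ℤ × ℤ)).symm
  refine ⟨fun n => V (eq n), ?_, ?_, ?_⟩
  · intro y hy
    let z : ℤ × ℤ := (⌊y 0 / r⌋, ⌊y 1 / r⌋)
    have hyz : y ∈ gridCell r z := ⟨rfl, rfl⟩
    refine Set.mem_iUnion.mpr ⟨eq.symm z, ?_⟩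
    rw [Equiv.apply_symm_apply]
    have : (gridCell r z ∩ S).Nonempty := ⟨y, hyz, hy⟩
    simp only [V, if_pos this]
    exact hyz
  · intro n
    refine (hVd _).trans (ENNReal.ofReal_le_ofReal ?_)
    exact mul_le_of_le_one_right (Real.sqrt_nonneg _) hr1
  · rw [eq.tsum_eq (fun z => EMetric.diam (V z) ^ d)]
    refine (ENNReal.tsum_le_tsum hpt).trans ?_
    rw [ENNReal.tsum_mul_left, ENNReal.tsum_add]
    refine (mul_le_mul_right (add_le_add hT hBs) _).trans ?_
    rw [← ENNReal.ofReal_add (by positivity) (by positivity), ← ENNReal.ofReal_mul (by positivity)]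
    exact ENNReal.ofReal_le_ofReal (final_ineq K L M r d hK hL hM hrdef hd1 hd2)
end

section
/- Let $K \ge L \ge 1$, $r > 0$, and let $f : \mathbb{D}^2_r \to \mathbb{R}^2$ be a $C^1$ diffeomorphism onto its image from the closed disk of radius $r$, with $\|Df\| \le K$ and $|\det Df| \le L$. Then there is a universal constant $C$ such that for all $1 \le d \le 2$ there exists a cover $(U_i)$ of $f(\mathbb{D}^2_r)$ with $\mathrm{diam}(U_i) \le \sqrt{2} L r / K$ for all $i$ and $\sum_i \mathrm{diam}(U_i)^d \le C \cdot r^d \cdot K^{2-d} \cdot L^{d-1}$. -/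
open Metric MeasureTheory

lemma log_homotopy {A : Type*} [TopologicalSpace A] (H : unitInterval × A → ℂ)
    (hc : Continuous H) (h0 : ∀ p, H p ≠ 0)
    (h : ∃ φ : A → ℂ, Continuous φ ∧ ∀ a, H (0, a) = Complex.exp (φ a)) :
    ∃ ψ : A → ℂ, Continuous ψ ∧ ∀ a, H (1, a) = Complex.exp (ψ a) := by
  obtain ⟨φ, hφ, h⟩ := h
  let H' : C(unitInterval × A, {z : ℂ // z ≠ 0}) :=
    ⟨fun p => ⟨H p, h0 p⟩, hc.subtype_mk _⟩
  have H0 : ∀ a, H' (0, a) = (fun z : ℂ ↦ (⟨_, z.exp_ne_zero⟩ : {z : ℂ // z ≠ 0}))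
      ((⟨φ, hφ⟩ : C(A, ℂ)) a) := fun a => Subtype.ext (h a)
  have L := Complex.isCoveringMap_exp.liftHomotopy_lifts H' ⟨φ, hφ⟩ H0
  refine ⟨fun a => Complex.isCoveringMap_exp.liftHomotopy H' ⟨φ, hφ⟩ H0 (1, a), ?_, fun a => ?_⟩
  · fun_prop
  · exact (congrArg Subtype.val (congrFun L (1, a))).symm

lemma topo (f : EuclideanSpace ℝ (Fin 2) → ℂ) (r : ℝ) (hr : 0 < r)
    (hf : ContinuousOn f (closedBall 0 r)) (hi : Set.InjOn f (closedBall 0 r))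
    (x : EuclideanSpace ℝ (Fin 2)) (hx : x ∈ closedBall 0 r) (y : ℂ)
    (hs : ∀ a ∈ sphere (0 : EuclideanSpace ℝ (Fin 2)) r, f a ∉ segment ℝ y (f x)) :
    y ∈ f '' closedBall 0 r := by
  by_contra hy
  have hxr : ‖x‖ < r := by
    rw [mem_closedBall_zero_iff] at hx
    refine lt_of_le_of_ne hx fun h => hs x (by simpa using h) (right_mem_segment ℝ _ _)
  let A := sphere (0 : EuclideanSpace ℝ (Fin 2)) r
  have hA : ∀ a : A, ‖(a : EuclideanSpace ℝ (Fin 2))‖ = r := fun a => by simpa using a.2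
  have hA0 : ∀ a : A, (a : EuclideanSpace ℝ (Fin 2)) ≠ 0 := fun a h => by
    have := hA a; rw [h, norm_zero] at this; linarith
  have hAc : ∀ a : A, (a : EuclideanSpace ℝ (Fin 2)) ∈ closedBall 0 r := fun a =>
    sphere_subset_closedBall a.2
  have hsc : ∀ (c : ℝ) (a : A), |c| ≤ 1 → c • (a : EuclideanSpace ℝ (Fin 2)) ∈ closedBall 0 r := by
    intro c a hc
    rw [mem_closedBall_zero_iff, norm_smul, hA a, Real.norm_eq_abs]
    nlinarith
  have hscx : ∀ t : unitInterval, ‖(1 - (t:ℝ)) • x‖ < r := by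
    intro t
    rw [norm_smul, Real.norm_eq_abs, abs_of_nonneg (by linarith [t.2.2])]
    have := t.2.1
    have := t.2.2
    nlinarith [norm_nonneg x]
  have s1 := log_homotopy (A := A) (fun p => f ((p.1 : ℝ) • (p.2 : EuclideanSpace ℝ (Fin 2))) - y)
    (by
      refine Continuous.sub (hf.comp_continuous (by fun_prop) fun p => hsc _ _ ?_) continuous_const
      rw [abs_of_nonneg p.1.2.1]; exact p.1.2.2)
    (fun p h => hy ⟨_, hsc p.1 p.2 (by rw [abs_of_nonneg p.1.2.1]; exact p.1.2.2),
      sub_eq_zero.1 h⟩)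
    ⟨fun _ => Complex.log (f 0 - y), continuous_const, fun a => by
      rw [Complex.exp_log]; · simp
      intro h
      exact hy ⟨0, by simp [hr.le], sub_eq_zero.1 h⟩⟩
  have hfA : Continuous (fun p : unitInterval × A => f p.2) :=
    hf.comp_continuous (by fun_prop) fun p => hAc p.2
  have s2 := log_homotopy (A := A) (fun p => f p.2 - AffineMap.lineMap y (f x) (p.1 : ℝ))
    (by
      refine hfA.sub ?_
      simp only [AffineMap.lineMap_apply]
      fun_prop)
    (fun p h => hs p.2 p.2.2 (by
      rw [sub_eq_zero.1 h, segment_eq_image_lineMap]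
      exact ⟨_, p.1.2, rfl⟩))
    (by simpa using s1)
  have s3 := log_homotopy (A := A) (fun p => f p.2 - f ((1 - (p.1 : ℝ)) • x))
    (by
      refine hfA.sub (hf.comp_continuous (by fun_prop) fun p => ?_)
      rw [mem_closedBall_zero_iff]; exact (hscx _).le)
    (fun p h => by
      have := hi (hAc p.2) (by rw [mem_closedBall_zero_iff]; exact (hscx _).le) (sub_eq_zero.1 h)
      have h2 := hscx p.1
      rw [← this, hA] at h2
      exact lt_irrefl _ h2)
    (by simpa using s2)
  have b1 : ∀ t : unitInterval, |1 - (t : ℝ) / 2| ≤ 1 := fun t => by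
    rw [abs_le]; constructor <;> linarith [t.2.1, t.2.2]
  have b2 : ∀ t : unitInterval, |- ((t : ℝ) / 2)| ≤ 1 := fun t => by
    rw [abs_le]; constructor <;> linarith [t.2.1, t.2.2]
  have s4 := log_homotopy (A := A) (fun p => f ((1 - (p.1 : ℝ) / 2) • (p.2 : EuclideanSpace ℝ (Fin 2)))
      - f ((-((p.1 : ℝ) / 2)) • (p.2 : EuclideanSpace ℝ (Fin 2))))
    (by
      refine (hf.comp_continuous (by fun_prop) fun p => hsc _ _ (b1 _)).sub
        (hf.comp_continuous (by fun_prop) fun p => hsc _ _ (b2 _)))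
    (fun p h => by
      have := hi (hsc _ _ (b1 _)) (hsc _ _ (b2 _)) (sub_eq_zero.1 h)
      have := smul_left_injective ℝ (hA0 p.2) this
      linarith)
    (by simpa using s3)
  obtain ⟨ψ, hψ, h4⟩ := s4
  have hpc : IsPreconnected A := isPreconnected_sphere (by
    rw [← Module.finrank_eq_rank, finrank_euclideanSpace_fin]; norm_num) 0 r
  have : PreconnectedSpace A := isPreconnected_iff_preconnectedSpace.1 hpc
  have key : ∀ a : A, Complex.exp (ψ (-a) - ψ a) = -1 := by
    intro a
    rw [Complex.exp_sub, ← h4, ← h4, div_eq_iff (by rw [h4]; exact Complex.exp_ne_zero _)]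
    have e1 : (1 - ((1 : unitInterval) : ℝ) / 2) = 1/2 := by norm_num
    have e2 : (-(((1 : unitInterval) : ℝ) / 2)) = -(1/2) := by norm_num
    have e3 : ((-a : A) : EuclideanSpace ℝ (Fin 2)) = - (a : EuclideanSpace ℝ (Fin 2)) := rfl
    simp only [e1, e2, e3]
    simp
  have hgc : Continuous (fun a : A => (ψ (-a) - ψ a).im) := by
    have : Continuous (fun a : A => -a) := by
      refine Continuous.subtype_mk (continuous_subtype_val.neg) _
    fun_prop
  obtain ⟨a0⟩ : Nonempty A := (NormedSpace.sphere_nonempty.2 hr.le).to_subtype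
  have hz : ∃ a : A, (ψ (-a) - ψ a).im = 0 := by
    have hneg : (ψ (-(-a0)) - ψ (-a0)).im = - (ψ (-a0) - ψ a0).im := by simp
    rcases le_total 0 ((ψ (-a0) - ψ a0).im) with h | h
    · exact mem_range_of_exists_le_of_exists_ge hgc ⟨-a0, by simp only [hneg]; linarith⟩ ⟨a0, h⟩
    · exact mem_range_of_exists_le_of_exists_ge hgc ⟨a0, h⟩ ⟨-a0, by simp only [hneg]; linarith⟩
  obtain ⟨a, ha⟩ := hz
  have := key a
  have hre := congrArg Complex.re this
  rw [Complex.exp_re, ha] at hre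
  simp at hre
  linarith [Real.exp_pos ((ψ (-a)).re - (ψ a).re)]

lemma topo' (f : EuclideanSpace ℝ (Fin 2) → EuclideanSpace ℝ (Fin 2)) (r : ℝ) (hr : 0 < r)
    (hf : ContinuousOn f (closedBall 0 r)) (hi : Set.InjOn f (closedBall 0 r))
    (Q : Set (EuclideanSpace ℝ (Fin 2))) (hQ : Convex ℝ Q)
    (hm : (Q ∩ f '' closedBall 0 r).Nonempty)
    (hs : ∀ a ∈ sphere (0 : EuclideanSpace ℝ (Fin 2)) r, f a ∉ Q) :
    Q ⊆ f '' closedBall 0 r := by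
  obtain ⟨_, hxQ, x, hx, rfl⟩ := hm
  intro y hy
  let e := Complex.orthonormalBasisOneI.repr.symm
  obtain ⟨z, hz, h⟩ := topo (fun x => e (f x)) r hr (e.continuous.comp_continuousOn hf)
    (e.injective.comp_injOn hi) x hx (e y) (by
      intro a ha h
      have : segment ℝ (e y) (e (f x)) = e '' segment ℝ y (f x) :=
        (image_segment ℝ e.toLinearEquiv.toLinearMap.toAffineMap y (f x)).symm
      rw [this] at h
      obtain ⟨w, hw, h⟩ := h
      rw [e.injective h] at hw
      exact hs a ha (hQ.segment_subset hy hxQ hw))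
  exact ⟨z, hz, e.injective h⟩

lemma circle_net (r : ℝ) (hr : 0 < r) (n : ℕ) (hn : 0 < n) :
    ∃ c : ℕ → EuclideanSpace ℝ (Fin 2), (∀ j, c j ∈ sphere 0 r) ∧
      ∀ a ∈ sphere (0 : EuclideanSpace ℝ (Fin 2)) r, ∃ j ∈ Finset.range (n + 1),
        ‖a - c j‖ ≤ 2 * Real.pi * r / n := by
  let e := Complex.orthonormalBasisOneI.repr
  have hn' : (0 : ℝ) < n := by exact_mod_cast hn
  have hpi := Real.pi_pos
  refine ⟨fun j => e (circleMap 0 r (-Real.pi + 2 * Real.pi * j / n)), fun j => ?_, fun a ha => ?_⟩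
  · rw [mem_sphere_zero_iff_norm, e.norm_map]
    simp [abs_of_pos hr]
  · rw [mem_sphere_zero_iff_norm] at ha
    set z := e.symm a with hz
    have hza : e z = a := by simp [hz]
    have hzn : ‖z‖ = r := by rw [← ha, ← hza, e.norm_map]
    set θ := Complex.arg z with hθ
    have hzc : z = circleMap 0 r θ := by
      rw [circleMap, zero_add, ← hzn, hθ, Complex.norm_mul_exp_arg_mul_I]
    have h1 : -Real.pi < θ := Complex.neg_pi_lt_arg z
    have h2 : θ ≤ Real.pi := Complex.arg_le_pi z
    have hs0 : 0 ≤ (θ + Real.pi) * n / (2 * Real.pi) := by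
      apply div_nonneg (mul_nonneg _ _) <;> linarith
    have hs1 : (θ + Real.pi) * n / (2 * Real.pi) ≤ n := by
      rw [div_le_iff₀ (by positivity)]; nlinarith
    set j := ⌊(θ + Real.pi) * n / (2 * Real.pi)⌋₊ with hj
    have hj1 : (j : ℝ) ≤ (θ + Real.pi) * n / (2 * Real.pi) := Nat.floor_le hs0
    have hj2 : (θ + Real.pi) * n / (2 * Real.pi) < j + 1 := Nat.lt_floor_add_one _
    refine ⟨j, ?_, ?_⟩
    · rw [Finset.mem_range, Nat.lt_succ_iff]
      exact_mod_cast hj1.trans hs1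
    · rw [← hza, ← map_sub, e.norm_map, hzc]
      have := (lipschitzWith_circleMap 0 r).dist_le_mul θ (-Real.pi + 2 * Real.pi * j / n)
      rw [dist_eq_norm, dist_eq_norm] at this
      refine this.trans ?_
      have hr' : ((Real.nnabs r : NNReal) : ℝ) = r := by simp [abs_of_pos hr]
      rw [hr', Real.norm_eq_abs]
      rw [le_div_iff₀ (by positivity)] at hj1
      rw [div_lt_iff₀ (by positivity)] at hj2
      have : |θ - (-Real.pi + 2 * Real.pi * j / n)| ≤ 2 * Real.pi / n := by
        have e1 : θ - (-Real.pi + 2 * Real.pi * j / n)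
          = ((θ + Real.pi) * n - j * (2 * Real.pi)) / n := by field_simp; ring
        rw [e1, abs_of_nonneg (div_nonneg (by linarith) hn'.le)]
        gcongr
        linarith
      calc r * _ ≤ r * (2 * Real.pi / n) := by gcongr
        _ = _ := by ring

/-- grid square -/
def gsq (δ : ℝ) (m : Fin 2 → ℤ) : Set (EuclideanSpace ℝ (Fin 2)) :=
  {y | ∀ i, ⌊y i / δ⌋ = m i}

lemma gsq_eq (δ : ℝ) (hδ : 0 < δ) (m : Fin 2 → ℤ) :
    gsq δ m = (WithLp.ofLp) ⁻¹' (Set.univ.pi fun i => Set.Ico (m i * δ) ((m i + 1) * δ)) := by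
  ext y
  simp only [gsq, Set.mem_ofPred_eq, Set.mem_preimage, Set.mem_univ_pi, Set.mem_Ico,
    Int.floor_eq_iff, le_div_iff₀ hδ, div_lt_iff₀ hδ]

lemma gsq_meas (δ : ℝ) (hδ : 0 < δ) (m : Fin 2 → ℤ) : MeasurableSet (gsq δ m) := by
  rw [gsq_eq δ hδ]
  exact (PiLp.volume_preserving_ofLp (Fin 2)).measurable
    (MeasurableSet.univ_pi fun i => measurableSet_Ico)

lemma gsq_vol (δ : ℝ) (hδ : 0 < δ) (m : Fin 2 → ℤ) :
    volume (gsq δ m) = ENNReal.ofReal (δ ^ 2) := by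
  rw [gsq_eq δ hδ, (PiLp.volume_preserving_ofLp (Fin 2)).measure_preimage
    (MeasurableSet.univ_pi fun i => measurableSet_Ico).nullMeasurableSet, Real.volume_pi_Ico]
  have : ∀ i, ((m i : ℝ) + 1) * δ - m i * δ = δ := fun i => by ring
  simp only [this]
  simp [ENNReal.ofReal_pow hδ.le]

lemma gsq_convex (δ : ℝ) (hδ : 0 < δ) (m : Fin 2 → ℤ) : Convex ℝ (gsq δ m) := by
  rw [gsq_eq δ hδ]
  exact (convex_pi fun i _ => convex_Ico _ _).linear_preimage
    (WithLp.linearEquiv 2 ℝ (Fin 2 → ℝ)).toLinearMap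

lemma gsq_dist (δ : ℝ) (hδ : 0 < δ) (m : Fin 2 → ℤ) (x y : EuclideanSpace ℝ (Fin 2))
    (hx : x ∈ gsq δ m) (hy : y ∈ gsq δ m) : dist x y ≤ √2 * δ := by
  rw [gsq_eq δ hδ] at hx hy
  simp only [Set.mem_preimage, Set.mem_univ_pi, Set.mem_Ico] at hx hy
  have h : ∀ i, dist (x i) (y i) ^ 2 ≤ δ ^ 2 := fun i => by
    have h1 := hx i
    have h2 := hy i
    rw [Real.dist_eq, sq_abs]
    apply sq_le_sq'
    · nlinarith
    · nlinarith
  rw [EuclideanSpace.dist_eq, Fin.sum_univ_two]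
  apply Real.sqrt_le_iff.2 ⟨by positivity, ?_⟩
  rw [mul_pow, Real.sq_sqrt (by norm_num)]
  linarith [h 0, h 1]

lemma floor_near_s2 (δ : ℝ) (hδ : 0 < δ) (x y : EuclideanSpace ℝ (Fin 2)) (h : dist x y ≤ 3 * δ) :
    (fun i => ⌊x i / δ⌋ : Fin 2 → ℤ) ∈ Finset.Icc (fun i => ⌊y i / δ⌋ - 4 : Fin 2 → ℤ)
      (fun i => ⌊y i / δ⌋ + 4) := by
  have h : ∀ i, |x i / δ - y i / δ| ≤ 3 := fun i => by
    rw [← sub_div, abs_div, abs_of_pos hδ, div_le_iff₀ hδ]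
    refine le_trans ?_ h
    rw [dist_eq_norm]
    exact PiLp.norm_apply_le (x - y) i
  rw [Finset.mem_Icc]
  constructor <;> intro i
  · have := abs_le.1 (h i)
    have h1 := Int.floor_le (y i / δ)
    rw [Int.le_floor]; push_cast; linarith
  · have := abs_le.1 (h i)
    have h1 := Int.lt_floor_add_one (y i / δ)
    have h2 := Int.floor_le (x i / δ)
    have : ((⌊x i / δ⌋ : ℤ) : ℝ) < ((⌊y i / δ⌋ + 4 : ℤ) : ℝ) := by push_cast; linarith
    exact_mod_cast this.le

lemma card_near (g : Fin 2 → ℤ) :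
    (Finset.Icc (fun i => g i - 4 : Fin 2 → ℤ) (fun i => g i + 4)).card = 81 := by
  have : ∀ i, g i + 4 + 1 - (g i - 4) = 9 := fun i => by ring
  simp [Pi.card_Icc, Int.card_Icc, this]

lemma card_area (δ : ℝ) (hδ : 0 < δ) (S : Finset (Fin 2 → ℤ))
    (F : Set (EuclideanSpace ℝ (Fin 2))) (M : ℝ) (hM : 0 ≤ M)
    (hS : ∀ m ∈ S, gsq δ m ⊆ F) (hvol : volume F ≤ ENNReal.ofReal (M * δ ^ 2)) :
    (S.card : ℝ) ≤ M := by
  have h1 : volume (⋃ m ∈ S, gsq δ m) ≤ ENNReal.ofReal (M * δ ^ 2) :=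
    (measure_mono (Set.iUnion₂_subset hS)).trans hvol
  have hdis : Set.PairwiseDisjoint (S : Set (Fin 2 → ℤ)) (gsq δ) := by
    intro m _ m' _ hne
    refine Set.disjoint_left.2 fun y hy hy' => hne ?_
    funext i
    exact (hy i).symm.trans (hy' i)
  rw [measure_biUnion_finset hdis (fun m _ => gsq_meas δ hδ m)] at h1
  simp only [gsq_vol δ hδ, Finset.sum_const, nsmul_eq_mul] at h1
  rw [← ENNReal.ofReal_natCast, ← ENNReal.ofReal_mul (by positivity),
    ENNReal.ofReal_le_ofReal_iff (by positivity)] at h1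
  exact le_of_mul_le_mul_right h1 (by positivity)

lemma counting (K L r : ℝ) (hL : 1 ≤ L) (hK : L ≤ K) (hr : 0 < r)
    (f : EuclideanSpace ℝ (Fin 2) → EuclideanSpace ℝ (Fin 2))
    (f' : EuclideanSpace ℝ (Fin 2) → (EuclideanSpace ℝ (Fin 2) →L[ℝ] EuclideanSpace ℝ (Fin 2)))
    (hc : ContinuousOn f (closedBall 0 r)) (hi : Set.InjOn f (closedBall 0 r))
    (hd : ∀ x ∈ closedBall (0 : EuclideanSpace ℝ (Fin 2)) r,
          HasFDerivWithinAt f (f' x) (closedBall (0 : EuclideanSpace ℝ (Fin 2)) r) x)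
    (hb : ∀ x ∈ closedBall (0 : EuclideanSpace ℝ (Fin 2)) r, ‖f' x‖ ≤ K)
    (hdet : ∀ x ∈ closedBall (0 : EuclideanSpace ℝ (Fin 2)) r, |(f' x).det| ≤ L) :
    ∃ T : Finset (Fin 2 → ℤ), (T.card : ℝ) ≤ 733 * (K ^ 2 / L) ∧
      f '' closedBall 0 r ⊆ ⋃ m ∈ T, gsq (L * r / K) m := by
  have hL0 : 0 < L := by linarith
  have hK0 : 0 < K := by linarith
  set δ := L * r / K with hδd
  have hδ : 0 < δ := by positivity
  have hKL : 1 ≤ K ^ 2 / L := by rw [le_div_iff₀ hL0]; nlinarith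
  have hvol : volume (f '' closedBall 0 r) ≤ ENNReal.ofReal (4 * (K ^ 2 / L) * δ ^ 2) := by
    rw [← lintegral_abs_det_fderiv_eq_addHaar_image volume measurableSet_closedBall hd hi]
    calc _ ≤ ∫⁻ x in closedBall (0 : EuclideanSpace ℝ (Fin 2)) r, ENNReal.ofReal L :=
          setLIntegral_mono measurable_const fun x hx => ENNReal.ofReal_le_ofReal (hdet x hx)
      _ = ENNReal.ofReal (L * (r ^ 2 * Real.pi)) := by
          rw [setLIntegral_const, EuclideanSpace.volume_closedBall_fin_two,
            ENNReal.ofReal_mul hL0.le, ENNReal.ofReal_mul (by positivity), ENNReal.ofReal_pow hr.le]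
      _ ≤ _ := by
          apply ENNReal.ofReal_le_ofReal
          have : 4 * (K ^ 2 / L) * δ ^ 2 = L * (r ^ 2 * 4) := by
            rw [hδd]; field_simp
          rw [this]
          gcongr
          exact Real.pi_le_four
  set A : Set (Fin 2 → ℤ) := {m | gsq δ m ⊆ f '' closedBall 0 r} with hA
  have hS : ∀ S : Finset (Fin 2 → ℤ), (S : Set (Fin 2 → ℤ)) ⊆ A → (S.card : ℝ) ≤ 4 * (K ^ 2 / L) := by
    intro S hS
    exact card_area δ hδ S _ _ (by positivity) (fun m hm => hS hm) hvol
  have hAf : A.Finite := by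
    by_contra hinf
    obtain ⟨S, hS1, hS2⟩ := Set.Infinite.exists_subset_card_eq hinf (⌈4 * (K ^ 2 / L)⌉₊ + 1)
    have := hS S hS1
    rw [hS2] at this
    push_cast at this
    linarith [Nat.le_ceil (4 * (K ^ 2 / L))]
  set n := ⌈7 * (K ^ 2 / L)⌉₊ with hn
  have hn1 : 7 * (K ^ 2 / L) ≤ n := Nat.le_ceil _
  have hn2 : (n : ℝ) < 7 * (K ^ 2 / L) + 1 := Nat.ceil_lt_add_one (by positivity)
  have hn0' : (0 : ℝ) < n := by linarith
  have hn0 : 0 < n := by exact_mod_cast hn0'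
  obtain ⟨c, hcs, hcn⟩ := circle_net r hr n hn0
  classical
  let N : ℕ → Finset (Fin 2 → ℤ) := fun j =>
    Finset.Icc (fun i => ⌊f (c j) i / δ⌋ - 4 : Fin 2 → ℤ) (fun i => ⌊f (c j) i / δ⌋ + 4)
  refine ⟨hAf.toFinset ∪ (Finset.range (n + 1)).biUnion N, ?_, ?_⟩
  · have h1 := hS hAf.toFinset (by simp)
    have h2 : ((Finset.range (n + 1)).biUnion N).card ≤ (n + 1) * 81 := by
      have := Finset.card_biUnion_le_card_mul (Finset.range (n + 1)) N 81
        (fun j _ => (card_near _).le)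
      simpa using this
    have h3 := Finset.card_union_le hAf.toFinset ((Finset.range (n + 1)).biUnion N)
    have h4 : ((hAf.toFinset ∪ (Finset.range (n + 1)).biUnion N).card : ℝ) ≤
        hAf.toFinset.card + (n + 1) * 81 := by exact_mod_cast h3.trans (by omega)
    linarith
  · intro y hy
    let m : Fin 2 → ℤ := fun i => ⌊y i / δ⌋
    have hym : y ∈ gsq δ m := fun i => rfl
    refine Set.mem_iUnion₂.2 ⟨m, ?_, hym⟩
    rw [Finset.mem_union]
    by_cases h : ∃ a ∈ sphere (0 : EuclideanSpace ℝ (Fin 2)) r, f a ∈ gsq δ m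
    · right
      obtain ⟨a, ha, ham⟩ := h
      obtain ⟨j, hj, hja⟩ := hcn a ha
      refine Finset.mem_biUnion.2 ⟨j, hj, floor_near_s2 δ hδ _ _ ?_⟩
      have h1 := gsq_dist δ hδ m y (f a) hym ham
      have h2 : dist (f a) (f (c j)) ≤ δ := by
        rw [dist_eq_norm]
        have := (convex_closedBall (0 : EuclideanSpace ℝ (Fin 2)) r).norm_image_sub_le_of_norm_hasFDerivWithin_le
          hd hb (sphere_subset_closedBall (hcs j)) (sphere_subset_closedBall ha)
        refine this.trans ?_
        calc K * ‖a - c j‖ ≤ K * (2 * Real.pi * r / n) := by gcongr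
          _ ≤ K * (7 * r / (7 * (K ^ 2 / L))) := by
            gcongr
            linarith [Real.pi_lt_d2]
          _ = δ := by rw [hδd]; field_simp
      have h3 : √2 ≤ 2 := Real.sqrt_le_iff.2 ⟨by norm_num, by norm_num⟩
      have h4 := dist_triangle y (f a) (f (c j))
      nlinarith
    · left
      push Not at h
      rw [Set.Finite.mem_toFinset]
      exact topo' f r hr hc hi _ (gsq_convex δ hδ m) ⟨y, hym, hy⟩ h

/-- Rescaled version of the unit-disk lemma: Hausdorff premeasure bound at scale
`√2·L·r/K` for the image of the disk of radius `r`. -/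
theorem stmt2 :
    ∃ C : ℝ, 0 < C ∧
      ∀ (K L r : ℝ), 1 ≤ L → L ≤ K → 0 < r →
      ∀ (f : EuclideanSpace ℝ (Fin 2) → EuclideanSpace ℝ (Fin 2))
        (f' : EuclideanSpace ℝ (Fin 2) → (EuclideanSpace ℝ (Fin 2) →L[ℝ] EuclideanSpace ℝ (Fin 2))),
        ContDiffOn ℝ 1 f (closedBall (0 : EuclideanSpace ℝ (Fin 2)) r) →
        Set.InjOn f (closedBall (0 : EuclideanSpace ℝ (Fin 2)) r) →
        (∀ x ∈ closedBall (0 : EuclideanSpace ℝ (Fin 2)) r,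
          HasFDerivWithinAt f (f' x) (closedBall (0 : EuclideanSpace ℝ (Fin 2)) r) x) →
        (∀ x ∈ closedBall (0 : EuclideanSpace ℝ (Fin 2)) r, ‖f' x‖ ≤ K) →
        (∀ x ∈ closedBall (0 : EuclideanSpace ℝ (Fin 2)) r, |(f' x).det| ≤ L) →
        ∀ d : ℝ, 1 ≤ d → d ≤ 2 →
        ∃ U : ℕ → Set (EuclideanSpace ℝ (Fin 2)),
          (f '' closedBall (0 : EuclideanSpace ℝ (Fin 2)) r ⊆ ⋃ i, U i) ∧
          (∀ i, EMetric.diam (U i) ≤ ENNReal.ofReal (Real.sqrt 2 * L * r / K)) ∧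
          ∑' i, EMetric.diam (U i) ^ d ≤
            ENNReal.ofReal (C * r ^ d * K ^ (2 - d) * L ^ (d - 1)) := by
  refine ⟨1466, by norm_num, ?_⟩
  intro K L r hL hK hr f f' hcd hi hd hb hdet d hd1 hd2
  obtain ⟨T, hT, hcov⟩ := counting K L r hL hK hr f f' hcd.continuousOn hi hd hb hdet
  have hL0 : 0 < L := by linarith
  have hK0 : 0 < K := by linarith
  set δ := L * r / K with hδd
  have hδ : 0 < δ := by positivity
  have hδ2 : Real.sqrt 2 * L * r / K = √2 * δ := by rw [hδd]; ring
  have hdiam : ∀ m, EMetric.diam (gsq δ m) ≤ ENNReal.ofReal (√2 * δ) := fun m =>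
    Metric.ediam_le_of_forall_dist_le fun x hx y hy => gsq_dist δ hδ m x y hx hy
  have hempty : EMetric.diam (∅ : Set (EuclideanSpace ℝ (Fin 2))) = 0 := Metric.ediam_empty
  let U : ℕ → Set (EuclideanSpace ℝ (Fin 2)) := fun i =>
    if h : i < T.card then gsq δ (T.equivFin.symm ⟨i, h⟩) else ∅
  have hU : ∀ i, EMetric.diam (U i) ≤ ENNReal.ofReal (√2 * δ) := by
    intro i
    by_cases h : i < T.card
    · simp only [U, h, dif_pos]; exact hdiam _
    · simp only [U, h, dif_neg, not_false_eq_true, hempty]; exact zero_le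
  refine ⟨U, ?_, ?_, ?_⟩
  · intro y hy
    obtain ⟨m, hm, hym⟩ := Set.mem_iUnion₂.1 (hcov hy)
    refine Set.mem_iUnion.2 ⟨(T.equivFin ⟨m, hm⟩ : Fin T.card), ?_⟩
    simpa [U] using hym
  · rw [hδ2]; exact hU
  · rw [tsum_eq_sum (s := Finset.range T.card)]
    · calc ∑ i ∈ Finset.range T.card, EMetric.diam (U i) ^ d
          ≤ ∑ i ∈ Finset.range T.card, ENNReal.ofReal (√2 * δ) ^ d :=
            Finset.sum_le_sum fun i _ => ENNReal.rpow_le_rpow (hU i) (by linarith)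
        _ = ENNReal.ofReal (T.card * (√2 * δ) ^ d) := by
            rw [Finset.sum_const, Finset.card_range, nsmul_eq_mul,
              ENNReal.ofReal_rpow_of_pos (by positivity), ENNReal.ofReal_mul (by positivity),
              ENNReal.ofReal_natCast]
        _ ≤ _ := by
            apply ENNReal.ofReal_le_ofReal
            have h2 : (√2 : ℝ) ^ d ≤ 2 := by
              calc (√2 : ℝ) ^ d ≤ (√2 : ℝ) ^ (2 : ℝ) :=
                    Real.rpow_le_rpow_of_exponent_le (Real.one_le_sqrt.2 (by norm_num)) hd2
                _ = 2 := by norm_num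
            rw [Real.mul_rpow (by positivity) hδ.le]
            have h3 : K ^ 2 / L * δ ^ d = r ^ d * K ^ (2 - d) * L ^ (d - 1) := by
              rw [hδd, Real.div_rpow (by positivity) hK0.le, Real.mul_rpow hL0.le hr.le,
                Real.rpow_sub hK0, Real.rpow_sub hL0, Real.rpow_one, Real.rpow_two]
              field_simp
            have hp : 0 < δ ^ d := by positivity
            calc (T.card : ℝ) * (√2 ^ d * δ ^ d) ≤ (733 * (K ^ 2 / L)) * (2 * δ ^ d) := by gcongr
              _ = 1466 * (K ^ 2 / L * δ ^ d) := by ring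
              _ = _ := by rw [h3]; ring
    · intro i hi
      have h : ¬ i < T.card := by simpa using hi
      simp only [U, h, dif_neg, not_false_eq_true, hempty]
      exact ENNReal.zero_rpow_of_pos (by linarith)
end
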